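/- arXiv:1901.10063 — 2 statements merged into one kernel-verified Lean document; each statement's English description precedes it below -/
import Mathlib

section
/- Let G = N × H be a finite abelian group, where N and H are subgroups of order q and p^k respectively, with p an odd prime, q a positive odd integer, and gcd(p, q) = 1. Let D be a regular Paley type partial difference set in G, and assume |G| is a perfect square. Let n ∈ N and let h ∈ H be a non-identity element of order p^r. Then nh ∈ D if and only if n h^x ∈ D for all integers x with 1 ≤ x ≤ p^r − 1 and gcd(x, p) = 1. -/
open Finset

/-- `D` is a `(v,k,l,m)`-partial difference set in `G`. -/
def IsPDS {G : Type*} [CommGroup G] [Fintype G] [DecidableEq G]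
    (D : Finset G) (v k l m : ℕ) : Prop :=
  Fintype.card G = v ∧ D.card = k ∧
  (∀ g : G, g ≠ 1 → g ∈ D →
    ((D ×ˢ D).filter (fun x => x.1 ≠ x.2 ∧ x.1 * x.2⁻¹ = g)).card = l) ∧
  (∀ g : G, g ≠ 1 → g ∉ D →
    ((D ×ˢ D).filter (fun x => x.1 ≠ x.2 ∧ x.1 * x.2⁻¹ = g)).card = m)

/-- A regular PDS: additionally `D⁽⁻¹⁾ = D` and `1 ∉ D`. -/
def IsRegularPDS {G : Type*} [CommGroup G] [Fintype G] [DecidableEq G]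
    (D : Finset G) (v k l m : ℕ) : Prop :=
  IsPDS D v k l m ∧ (∀ d : G, d ∈ D ↔ d⁻¹ ∈ D) ∧ (1 : G) ∉ D

/-- A regular Paley type PDS. -/
def IsPaleyPDS {G : Type*} [CommGroup G] [Fintype G] [DecidableEq G]
    (D : Finset G) : Prop :=
  ∃ k l m : ℕ, IsRegularPDS D (Fintype.card G) k l m ∧
    Fintype.card G = 2 * k + 1 ∧ Fintype.card G = 4 * l + 5 ∧ Fintype.card G = 4 * m + 1

lemma paley_sq {G : Type*} [CommGroup G] [Fintype G] [DecidableEq G]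
    (R : Type*) [CommRing R] (D : Finset G) (v k l m : ℕ) (hD : IsRegularPDS D v k l m) :
    (∑ g ∈ D, MonoidAlgebra.of R G g) * (∑ g ∈ D, MonoidAlgebra.of R G g)
      = (k : MonoidAlgebra R G) + (l : MonoidAlgebra R G) * (∑ g ∈ D, MonoidAlgebra.of R G g)
        + (m : MonoidAlgebra R G) * ((∑ g : G, MonoidAlgebra.of R G g) - 1
          - ∑ g ∈ D, MonoidAlgebra.of R G g) := by
  obtain ⟨⟨hv, hk, hl, hm⟩, hinv, h1⟩ := hD
  have e1 : (∑ g ∈ D, MonoidAlgebra.of R G g) = ∑ g ∈ D, MonoidAlgebra.of R G g⁻¹ := by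
    refine Finset.sum_bij' (fun g _ => g⁻¹) (fun g _ => g⁻¹) ?_ ?_ ?_ ?_ ?_
    · intro a ha; exact (hinv a).1 ha
    · intro a ha; exact (hinv a).1 ha
    · simp
    · simp
    · simp
  have e2 : (∑ g ∈ D, MonoidAlgebra.of R G g) * (∑ g ∈ D, MonoidAlgebra.of R G g)
      = ∑ g : G, (((D ×ˢ D).filter (fun x => x.1 * x.2⁻¹ = g)).card : MonoidAlgebra R G)
          * MonoidAlgebra.of R G g := by
    conv_lhs => rw [e1]
    conv_lhs => 
      arg 1
      rw [← e1]
    rw [Finset.sum_mul_sum, ← Finset.sum_product',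
      ← Finset.sum_fiberwise (D ×ˢ D) (fun x => x.1 * x.2⁻¹)]
    refine Finset.sum_congr rfl fun g _ => ?_
    rw [← nsmul_eq_mul, ← Finset.sum_const]
    refine Finset.sum_congr rfl fun x hx => ?_
    rw [← map_mul, (Finset.mem_filter.1 hx).2]
  have e3 : ∀ g : G, (((D ×ˢ D).filter (fun x => x.1 * x.2⁻¹ = g)).card : MonoidAlgebra R G)
      = (if g = 1 then (k : MonoidAlgebra R G) - m else 0)
        + (if g ∈ D then (l : MonoidAlgebra R G) - m else 0) + m := by
    intro g
    by_cases hg : g = 1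
    · subst hg
      have : ((D ×ˢ D).filter (fun x => x.1 * x.2⁻¹ = 1)) = D.image (fun d => (d, d)) := by
        ext ⟨a, b⟩
        simp only [Finset.mem_filter, Finset.mem_product, Finset.mem_image, Prod.mk.injEq,
          mul_inv_eq_one]
        constructor
        · rintro ⟨⟨ha, hb⟩, rfl⟩; exact ⟨a, ha, rfl, rfl⟩
        · rintro ⟨c, hc, rfl, rfl⟩; exact ⟨⟨hc, hc⟩, rfl⟩
      rw [this, Finset.card_image_of_injective _ (fun a b hab => (Prod.mk.inj hab).1), hk]
      simp [h1]
    · have : ((D ×ˢ D).filter (fun x => x.1 * x.2⁻¹ = g))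
          = ((D ×ˢ D).filter (fun x => x.1 ≠ x.2 ∧ x.1 * x.2⁻¹ = g)) := by
        refine Finset.filter_congr fun x _ => ?_
        constructor
        · intro hx
          refine ⟨fun he => hg ?_, hx⟩
          rw [← hx, he, mul_inv_cancel]
        · exact fun hx => hx.2
      rw [this]
      by_cases hgD : g ∈ D
      · rw [hl g hg hgD]; simp [hg, hgD]
      · rw [hm g hg hgD]; simp [hg, hgD]
  rw [e2]
  simp_rw [e3, add_mul, Finset.sum_add_distrib, ite_mul, zero_mul]
  rw [Finset.sum_ite_eq' Finset.univ (1 : G), ← Finset.sum_filter, ← Finset.mul_sum,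
    ← Finset.mul_sum]
  have : (Finset.univ.filter (fun g => g ∈ D)) = D := by ext; simp
  rw [this, map_one]
  simp only [Finset.mem_univ, if_true]
  ring

lemma paley_prime {G : Type*} [CommGroup G] [Fintype G] [DecidableEq G]
    (D : Finset G) (hD : IsPaleyPDS D) (hsq : IsSquare (Fintype.card G))
    (t : ℕ) (ht : t.Prime) (ht2 : 2 < t) (hco : Nat.Coprime (Fintype.card G) t) (g : G) :
    g ∈ D ↔ g ^ t ∈ D := by
  obtain ⟨k, l, m, hreg, hk, hl, hm⟩ := hD
  have : Fact t.Prime := ⟨ht⟩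
  have hS := paley_sq (ZMod t) D _ k l m hreg
  have : CharP (MonoidAlgebra (ZMod t) G) t := charP_of_injective_algebraMap' (ZMod t) t
  have hDc : D.card = k := hreg.1.2.1
  have hinj : Function.Injective (fun x : G => x ^ t) :=
    (powCoprime (G := G) (n := t) (by rwa [Nat.card_eq_fintype_card])).injective
  have hbij : Function.Bijective (fun x : G => x ^ t) := Finite.injective_iff_bijective.1 hinj
  set d : MonoidAlgebra (ZMod t) G := ∑ g ∈ D, MonoidAlgebra.of (ZMod t) G g with hd
  set u : MonoidAlgebra (ZMod t) G := ∑ g : G, MonoidAlgebra.of (ZMod t) G g with hu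
  have hgu : ∀ a : G, MonoidAlgebra.of (ZMod t) G a * u = u := by
    intro a
    rw [hu, Finset.mul_sum]
    simp_rw [← map_mul]
    exact Equiv.sum_comp (Equiv.mulLeft a) (fun g => MonoidAlgebra.of (ZMod t) G g)
  have hdu : d * u = k * u := by
    rw [hd, Finset.sum_mul, Finset.sum_congr rfl (fun a _ => hgu a), Finset.sum_const, hDc,
      nsmul_eq_mul]
  have huu : u * u = (Fintype.card G : MonoidAlgebra (ZMod t) G) * u := by
    conv_lhs =>
      arg 1
      rw [hu]
    rw [Finset.sum_mul, Finset.sum_congr rfl (fun a _ => hgu a), Finset.sum_const,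
      nsmul_eq_mul, Finset.card_univ]
  have hk' : (Fintype.card G : MonoidAlgebra (ZMod t) G) = 2 * k + 1 := by rw [hk]; push_cast; rfl
  have hl' : (Fintype.card G : MonoidAlgebra (ZMod t) G) = 4 * l + 5 := by rw [hl]; push_cast; rfl
  have hm' : (Fintype.card G : MonoidAlgebra (ZMod t) G) = 4 * m + 1 := by rw [hm]; push_cast; rfl
  obtain ⟨w, hw⟩ := hsq
  have hw' : (Fintype.card G : MonoidAlgebra (ZMod t) G) = w ^ 2 := by rw [hw]; push_cast; ring
  have hwt : ((w : ZMod t)) ≠ 0 := by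
    intro h0
    rw [ZMod.natCast_eq_zero_iff] at h0
    have : t ∣ Fintype.card G := hw ▸ h0.mul_right w
    exact ht.one_lt.ne' (Nat.eq_one_of_dvd_coprimes hco this dvd_rfl)
  have hw1 : (w : MonoidAlgebra (ZMod t) G) ^ (t - 1) = 1 := by
    have := congrArg (algebraMap (ZMod t) (MonoidAlgebra (ZMod t) G)) (ZMod.pow_card_sub_one_eq_one hwt)
    simpa only [map_pow, map_natCast, map_one] using this
  have h2t : (2 : MonoidAlgebra (ZMod t) G) ^ t = 2 := by
    have := congrArg (algebraMap (ZMod t) (MonoidAlgebra (ZMod t) G)) (ZMod.pow_card (2 : ZMod t))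
    simpa only [map_pow, map_ofNat] using this
  generalize hV : (Fintype.card G : MonoidAlgebra (ZMod t) G) = V at *
  have hSS : (2 * d + 1 - u) ^ 2 = V - u := by
    linear_combination 4 * hS + (-4) * hdu + huu + (-2 + 2 * u) * hk' + (-d) * hl' + (d - u + 1) * hm'
  have hSu : (2 * d + 1 - u) * u = 0 := by
    linear_combination 2 * hdu - huu - u * hk'
  have hpow : ∀ j : ℕ, (2 * d + 1 - u) ^ (2 * j + 1) = V ^ j * (2 * d + 1 - u) := by
    intro j
    induction j with
    | zero => simp
    | succ j ih =>
      have : (2 * d + 1 - u) ^ (2 * (j + 1) + 1)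
          = (2 * d + 1 - u) ^ (2 * j + 1) * (2 * d + 1 - u) ^ 2 := by ring
      rw [this, ih, hSS]
      linear_combination (-V ^ j) * hSu
  obtain ⟨j, hj⟩ := ht.odd_of_ne_two ht2.ne'
  have hfin : (2 * d + 1 - u) ^ t = 2 * d + 1 - u := by
    have e : V ^ j = 1 := by
      rw [hw', ← pow_mul, ← hw1]; congr 1; omega
    have := hpow j
    rw [e, one_mul, ← hj] at this
    exact this
  rw [sub_pow_char, add_pow_char, mul_pow, h2t, one_pow] at hfin
  have hut : u ^ t = u := by
    rw [hu, sum_pow_char]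
    simp_rw [← map_pow]
    exact hbij.sum_comp (fun g => MonoidAlgebra.of (ZMod t) G g)
  rw [hut] at hfin
  have h2d : 2 * d ^ t = 2 * d := by linear_combination hfin
  have h20 : (2 : ZMod t) ≠ 0 := by
    intro h0
    have : ((2 : ℕ) : ZMod t) = 0 := by exact_mod_cast h0
    rw [ZMod.natCast_eq_zero_iff] at this
    exact absurd (Nat.le_of_dvd (by norm_num) this) (by omega)
  have hdt : d ^ t = d := by
    have e : algebraMap (ZMod t) (MonoidAlgebra (ZMod t) G) (2⁻¹ * 2) = 1 := by
      rw [inv_mul_cancel₀ h20, map_one]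
    rw [map_mul, map_ofNat] at e
    linear_combination (algebraMap (ZMod t) (MonoidAlgebra (ZMod t) G) 2⁻¹) * h2d
      + (d - d ^ t) * e
  rw [hd, sum_pow_char] at hdt
  have hc := congrArg (fun z => z.coeff (g ^ t)) hdt
  have hinj' : ∀ x : G, x ^ t = g ^ t ↔ x = g := fun x => hinj.eq_iff
  simp_rw [← map_pow] at hc
  simp only [MonoidAlgebra.coeff_sum, Finsupp.finsetSum_apply, MonoidAlgebra.of_apply,
    MonoidAlgebra.coeff_single, Finsupp.single_apply, hinj', Finset.sum_ite_eq'] at hc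
  by_cases a : g ∈ D <;> by_cases b : g ^ t ∈ D <;> simp [a, b] at hc ⊢

/-- Let `G = N × H` with `|N| = q`, `|H| = p^k`, `p` an odd prime, `q` an odd positive
integer, `gcd(p,q) = 1`. Let `D` be a regular Paley type PDS in `G`, with `|G|` a perfect
square. If `h ∈ H` is a non-identity element of order `p^r` and `n ∈ N`, then `nh ∈ D` iff
`n h^x ∈ D` for all `x` with `1 ≤ x ≤ p^r - 1` and `gcd(x, p) = 1`. -/
theorem stmt2 {N H : Type*} [CommGroup N] [Fintype N] [DecidableEq N]
    [CommGroup H] [Fintype H] [DecidableEq H]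
    (p q k : ℕ) (hp : p.Prime) (hpodd : Odd p) (hq : Odd q) (hq0 : 0 < q)
    (hpq : Nat.gcd p q = 1)
    (hN : Fintype.card N = q) (hH : Fintype.card H = p ^ k)
    (hsq : IsSquare (Fintype.card (N × H)))
    (D : Finset (N × H)) (hD : IsPaleyPDS D)
    (n : N) (h : H) (hne : h ≠ 1) (r : ℕ) (hr : orderOf h = p ^ r) :
    (n, h) ∈ D ↔ ∀ x : ℕ, 1 ≤ x → x ≤ p ^ r - 1 → Nat.gcd x p = 1 → (n, h ^ x) ∈ D := by
  have hr0 : r ≠ 0 := by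
    rintro rfl
    rw [pow_zero, orderOf_eq_one_iff] at hr
    exact hne hr
  constructor
  · intro hmem x _ _ hx
    have hcop : Nat.Coprime q (p ^ k) := (Nat.Coprime.pow_left k hpq).symm
    obtain ⟨t, ht1, ht2⟩ := Nat.chineseRemainder hcop 1 x
    have hv : Fintype.card (N × H) = q * p ^ k := by rw [Fintype.card_prod, hN, hH]
    have c1 : Nat.Coprime t q := by
      have := ht1.gcd_eq
      simpa [Nat.Coprime] using this
    have c2 : Nat.Coprime t (p ^ k) := by
      have h1 := ht2.gcd_eq
      have h2 : Nat.Coprime x (p ^ k) := Nat.Coprime.pow_right k hx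
      exact h1.trans h2
    have ct : Nat.Coprime t (q * p ^ k) := Nat.Coprime.mul_right c1 c2
    have hv0 : q * p ^ k ≠ 0 := Nat.mul_ne_zero hq0.ne' (pow_ne_zero _ hp.ne_zero)
    obtain ⟨s, hs2, hsp, hst⟩ := Nat.forall_exists_prime_gt_and_modEq 2 hv0 ct
    have cs : Nat.Coprime (Fintype.card (N × H)) s := by
      rw [hv]
      have h1 : Nat.gcd s (q * p ^ k) = Nat.gcd t (q * p ^ k) := hst.gcd_eq
      have h2 : Nat.Coprime s (q * p ^ k) := h1.trans ct
      exact h2.symm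
    have key := (paley_prime D hD hsq s hsp hs2 cs (n, h)).1 hmem
    have hn : n ^ s = n := by
      conv_rhs => rw [← pow_one n]
      rw [pow_eq_pow_iff_modEq]
      refine ((hst.of_mul_right _).trans ht1).of_dvd ?_
      rw [← hN]; exact orderOf_dvd_card
    have hh : h ^ s = h ^ x := by
      rw [pow_eq_pow_iff_modEq]
      refine ((hst.of_mul_left _).trans ht2).of_dvd ?_
      rw [← hH]; exact orderOf_dvd_card
    rw [Prod.pow_mk, hn, hh] at key
    exact key
  · intro hall
    have h1 : 1 ≤ p ^ r - 1 := by
      have : p ^ 1 ≤ p ^ r := Nat.pow_le_pow_right hp.pos (Nat.one_le_iff_ne_zero.2 hr0)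
      rw [pow_one] at this
      have := hp.two_le
      omega
    simpa using hall 1 le_rfl h1 (Nat.gcd_one_left p)
end

section
/- Let G = ℤ₂ × ℤ₂ × P be a finite abelian group, where P is an abelian group of order p^{2α} with p an odd prime and α an odd positive integer. If there exists a Hadamard difference set in G, i.e., a (4m², 2m² − m, m² − m)-difference set for some positive integer m (here 4m² = |G|), then p ≡ 3 (mod 4). -/
open Finset

/-- `D` is a `(v,k,l)`-difference set in `G`: every non-identity element of `G` has exactly
`l` representations as `d₁ * d₂⁻¹` with `d₁, d₂ ∈ D`. -/
def IsDS {G : Type*} [CommGroup G] [Fintype G] [DecidableEq G]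
    (D : Finset G) (v k l : ℕ) : Prop :=
  Fintype.card G = v ∧ D.card = k ∧
  (∀ g : G, g ≠ 1 →
    ((D ×ˢ D).filter (fun x => x.1 * x.2⁻¹ = g)).card = l)

namespace HDS
open NumberField IsCyclotomicExtension

/-- Galois automorphism raising the primitive root to the power `t`. -/
lemma exists_aut {n : ℕ} [NeZero n] {K : Type*} [Field K] [NumberField K]
    [IsCyclotomicExtension {n} ℚ K] (t : ℕ) (ht : t.Coprime n) :
    ∃ σ : K ≃ₐ[ℚ] K, ∀ x : K, x ^ n = 1 → σ x = x ^ t := by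
  have hz := zeta_spec n ℚ K
  have hirr := Polynomial.cyclotomic.irreducible_rat (NeZero.pos n)
  refine ⟨fromZetaAut (hz.pow_of_coprime t ht) hirr, fun x hx => ?_⟩
  obtain ⟨i, -, rfl⟩ := hz.eq_pow_of_pow_eq_one hx
  rw [map_pow, fromZetaAut_spec, ← pow_mul, ← pow_mul, mul_comm]

lemma embed_conj {n : ℕ} [NeZero n] {K : Type*} [Field K] [NumberField K]
    [IsCyclotomicExtension {n} ℚ K] (σ : K ≃ₐ[ℚ] K) (hσ : ∀ x : K, x ^ n = 1 → σ x = x⁻¹)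
    (φ : K →+* ℂ) (x : K) : φ (σ x) = (starRingEnd ℂ) (φ x) := by
  have hz := zeta_spec n ℚ K
  let f : K →ₐ[ℚ] ℂ := (φ.toRatAlgHom).comp σ.toAlgHom
  let g : K →ₐ[ℚ] ℂ := ((starRingEnd ℂ).comp φ).toRatAlgHom
  have : f = g := by
    apply (hz.powerBasis ℚ).algHom_ext
    simp only [IsPrimitiveRoot.powerBasis_gen]
    change φ (σ (zeta n ℚ K)) = (starRingEnd ℂ) (φ (zeta n ℚ K))
    rw [hσ _ hz.pow_eq_one, map_inv₀]
    apply Complex.inv_eq_conj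
    apply Complex.norm_eq_one_of_pow_eq_one (n := n) _ (NeZero.ne n)
    rw [← map_pow, hz.pow_eq_one, map_one]
  exact DFunLike.congr_fun this x

lemma key_root {p k : ℕ} [hp : Fact p.Prime] (hodd : Odd p) {K : Type*} [Field K] [NumberField K]
    [IsCyclotomicExtension {p ^ (k+1)} ℚ K] (σ : K ≃ₐ[ℚ] K)
    (hσ : ∀ x : K, x ^ (p ^ (k+1)) = 1 → σ x = x⁻¹) (a : ℕ) (z : K) (hz : IsIntegral ℤ z)
    (h : z * σ z = (p : K) ^ (2 * a)) :
    ∃ η : K, η ^ (p ^ (k+1)) = 1 ∧ (z = (p:K) ^ a * η ∨ z = - ((p:K) ^ a * η)) := by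
  have : NeZero (p ^ (k+1)) := ⟨pow_ne_zero _ hp.out.ne_zero⟩
  set n := p ^ (k+1) with hn
  have hζ := zeta_spec n ℚ K
  have hζ' : IsPrimitiveRoot (zeta n ℚ K) (p ^ (k+1)) := hζ
  set ζ := zeta n ℚ K
  have hp0 : (p : K) ≠ 0 := Nat.cast_ne_zero.2 hp.out.ne_zero
  -- associated
  let Z : 𝓞 K := ⟨z, hz⟩
  let τ : 𝓞 K ≃+* 𝓞 K := RingOfIntegers.mapRingEquiv σ.toRingEquiv
  have hτ (x : 𝓞 K) : ((τ x : 𝓞 K) : K) = σ x := rfl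
  have hZ : Z * τ Z = (p : 𝓞 K) ^ (2 * a) := by
    apply RingOfIntegers.ext
    push_cast
    exact h
  set π : 𝓞 K := hζ'.toInteger - 1 with hπ
  have hπp : Prime π := hζ'.zeta_sub_one_prime
  obtain ⟨N, hN⟩ : ∃ N, Associated (p : 𝓞 K) (π ^ N) := by
    have := Rat.map_eq_span_zeta_sub_one_pow p k hζ'
    rw [Ideal.map_span, Set.image_singleton, Ideal.span_singleton_pow,
      Ideal.span_singleton_eq_span_singleton] at this
    exact ⟨_, by simpa using this⟩
  have hτπ : Associated (τ π) π := by
    have : τ π * hζ'.toInteger = -π := by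
      apply RingOfIntegers.ext
      have h1 : σ ζ = ζ⁻¹ := hσ _ hζ.pow_eq_one
      have h0 : ζ ≠ 0 := hζ.ne_zero (NeZero.ne n)
      have h2 : ((hζ'.toInteger : 𝓞 K) : K) = ζ := rfl
      push_cast [hτ, hπ, h2]
      simp only [map_sub, map_one, h1]
      field_simp
      ring
    have hu : IsUnit (hζ'.toInteger : 𝓞 K) := hζ'.toInteger_isPrimitiveRoot.isUnit (NeZero.ne n)
    have h3 : Associated (τ π * hζ'.toInteger) (τ π) := by
      obtain ⟨u, hu⟩ := hu
      rw [← hu]; exact (associated_mul_unit_left _ _ u.isUnit)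
    rw [this] at h3
    exact h3.symm.trans (Associated.neg_left (Associated.refl _))
  have hass : Associated (τ Z) Z := by
    have : Z ∣ π ^ (N * (2 * a)) := by
      rw [pow_mul]
      exact (Dvd.intro _ hZ).trans (hN.pow_pow).dvd
    obtain ⟨i, -, hi⟩ := (dvd_prime_pow hπp _).1 this
    have h1 : Associated (τ Z) (τ (π ^ i)) := hi.map (τ : 𝓞 K →* 𝓞 K)
    rw [map_pow] at h1
    exact (h1.trans hτπ.pow_pow).trans hi.symm
  obtain ⟨u, hu⟩ := hass
  have hu' : σ z * ((u : 𝓞 K) : K) = z := congrArg (fun x : 𝓞 K => (x : K)) hu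
  have hσz : σ z ≠ 0 := by
    intro h0; rw [h0, mul_zero] at h; exact pow_ne_zero _ hp0 h.symm
  have hz0 : z ≠ 0 := by
    intro h0; rw [h0, zero_mul] at h; exact pow_ne_zero _ hp0 h.symm
  obtain ⟨m, hm0, hm⟩ := NumberField.Embeddings.pow_eq_one_of_norm_eq_one K ℂ
    (x := ((u : 𝓞 K) : K)) (RingOfIntegers.isIntegral_coe _) (fun φ => by
      have h1 := congrArg φ hu'
      rw [map_mul, embed_conj σ hσ φ] at h1
      have h2 := congrArg norm h1
      rw [norm_mul, RCLike.norm_conj] at h2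
      have : ‖φ z‖ ≠ 0 := by simpa using hz0
      field_simp at h2
      exact h2)
  have hfin : IsOfFinOrder (z / (p : K) ^ a) := by
    rw [isOfFinOrder_iff_pow_eq_one]
    refine ⟨2 * m, by omega, ?_⟩
    rw [pow_mul]
    have : (z / (p : K) ^ a) ^ 2 = ((u : 𝓞 K) : K) := by
      rw [div_pow, ← pow_mul, mul_comm a 2, ← h, div_eq_iff (mul_ne_zero hz0 hσz)]
      linear_combination (-z) * hu'
    rw [this, hm]
  obtain ⟨r, -, hr⟩ := hζ.exists_pow_or_neg_mul_pow_of_isOfFinOrder (hodd.pow) hfin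
  refine ⟨ζ ^ r, by rw [← pow_mul, mul_comm, pow_mul, hζ.pow_eq_one, one_pow], ?_⟩
  have hpa := pow_ne_zero a hp0
  rcases hr with hr | hr
  · left; rw [← hr]; field_simp
  · right; rw [← mul_neg, ← hr]; field_simp

lemma two_not_dvd {K : Type*} [Field K] [NumberField K] (m : ℕ) (hm : Odd m) :
    ¬ (2 : 𝓞 K) ∣ (m : 𝓞 K) := by
  rintro ⟨w, hw⟩
  have h1 : IsIntegral ℤ ((m / 2 : ℚ)) := by
    rw [← isIntegral_algebraMap_iff (B := K) (algebraMap ℚ K).injective]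
    have : algebraMap ℚ K (m / 2 : ℚ) = (w : K) := by
      have := congrArg (fun x : 𝓞 K => (x : K)) hw
      push_cast [show ((2 : 𝓞 K) : K) = 2 from rfl] at this
      simp [this]
    rw [this]
    exact RingOfIntegers.isIntegral_coe _
  obtain ⟨y, hy⟩ := IsIntegrallyClosed.isIntegral_iff.1 h1
  simp only [algebraMap_int_eq, eq_intCast] at hy
  field_simp at hy
  have h2 : y * 2 = m := by exact_mod_cast hy
  obtain ⟨c, rfl⟩ := hm
  omega

lemma root_eq_one {K : Type*} [Field K] [NumberField K] (θ : 𝓞 K) (n c : ℕ) (hn : Odd n)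
    (hc : Odd c) (hθ : θ ^ n = 1) (h : (2 : 𝓞 K) ∣ c * (θ - 1)) : θ = 1 := by
  by_contra hne
  have h0 : ∑ i ∈ range n, θ ^ i = 0 := by
    have := mul_geom_sum θ n
    rw [hθ, sub_self] at this
    exact (mul_eq_zero.1 this).resolve_left (sub_ne_zero.2 hne)
  have h1 : (2 : 𝓞 K) ∣ ∑ i ∈ range n, (c : 𝓞 K) * (θ ^ i - 1) := by
    apply Finset.dvd_sum
    intro i _
    have : θ - 1 ∣ θ ^ i - 1 := by simpa using sub_dvd_pow_sub_pow θ 1 i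
    exact h.trans (mul_dvd_mul_left _ this)
  rw [← Finset.mul_sum, Finset.sum_sub_distrib, h0] at h1
  apply two_not_dvd (K := K) (c * n) (hc.mul hn)
  simpa using h1

section GR
variable {P : Type*} [CommGroup P]

/-- The involution `g ↦ g⁻¹` on the integral group ring. -/
noncomputable def iv (P : Type*) [CommGroup P] : MonoidAlgebra ℤ P →ₐ[ℤ] MonoidAlgebra ℤ P :=
  MonoidAlgebra.mapDomainAlgHom ℤ ℤ (invMonoidHom : P →* P)

lemma iv_single (g : P) (c : ℤ) : iv P (.single g c) = .single g⁻¹ c := by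
  simp [iv]

/-- Evaluation at a character. -/
noncomputable def ev {K : Type*} [Field K] (χ : P →* K) : MonoidAlgebra ℤ P →ₐ[ℤ] K :=
  MonoidAlgebra.lift ℤ K P χ

lemma ev_single {K : Type*} [Field K] (χ : P →* K) (g : P) (c : ℤ) :
    ev χ (.single g c) = c * χ g := by
  simp [ev]

lemma ev_eq_sum [Fintype P] {K : Type*} [Field K] (χ : P →* K) (X : MonoidAlgebra ℤ P) :
    ev χ X = ∑ g, (X.coeff g : K) * χ g := by
  rw [ev, MonoidAlgebra.lift_apply, Finsupp.sum_fintype _ _ (by simp)]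
  simp

lemma ev_isIntegral [Finite P] {K : Type*} [Field K] (χ : P →* K) (X : MonoidAlgebra ℤ P) :
    IsIntegral ℤ (ev χ X) := by
  have := Fintype.ofFinite P
  rw [ev_eq_sum]
  apply IsIntegral.sum
  intro g _
  apply IsIntegral.mul
  · exact isIntegral_algebraMap (R := ℤ) (A := K)
  · apply IsIntegral.of_pow (n := Fintype.card P) Fintype.card_pos
    rw [← map_pow, pow_card_eq_one, map_one]
    exact isIntegral_one

lemma aut_ev [Fintype P] {K : Type*} [Field K] [Algebra ℚ K] (σ : K ≃ₐ[ℚ] K)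
    (hσ : ∀ x : K, x ^ Fintype.card P = 1 → σ x = x⁻¹) (χ : P →* K) (X : MonoidAlgebra ℤ P) :
    σ (ev χ X) = ev χ (iv P X) := by
  induction X using MonoidAlgebra.induction_linear with
  | zero => simp
  | add f g hf hg => simp [hf, hg]
  | single g c =>
    rw [iv_single, ev_single, ev_single, map_mul, map_intCast,
      hσ (χ g) (by rw [← map_pow, pow_card_eq_one, map_one])]
    congr 1
    symm
    apply eq_inv_of_mul_eq_one_left
    rw [← map_mul, inv_mul_cancel, map_one]

lemma aut_inv {n : ℕ} [NeZero n] {K : Type*} [Field K] [NumberField K]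
    [IsCyclotomicExtension {n} ℚ K] : ∃ σ : K ≃ₐ[ℚ] K, ∀ x : K, x ^ n = 1 → σ x = x⁻¹ := by
  have h1 : 1 ≤ n := NeZero.one_le
  obtain ⟨σ, hσ⟩ := exists_aut (n := n) (K := K) (n - 1) (by
    rw [Nat.coprime_self_sub_left h1]; simp)
  refine ⟨σ, fun x hx => ?_⟩
  rw [hσ x hx]
  apply eq_inv_of_mul_eq_one_left
  rw [← pow_succ, Nat.sub_add_cancel h1, hx]

lemma ev_int [Fintype P] {p k : ℕ} [hp : Fact p.Prime] (hodd : Odd p) {K : Type*} [Field K]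
    [NumberField K] [IsCyclotomicExtension {p ^ (k+1)} ℚ K] (hP : Fintype.card P = p ^ (k+1))
    (χ : P →* K) (a : ℕ) (X Y Z : MonoidAlgebra ℤ P)
    (hX : X * iv P X = (p : MonoidAlgebra ℤ P) ^ (2 * a))
    (hY : Y * iv P Y = (p : MonoidAlgebra ℤ P) ^ (2 * a))
    (hZ : X - Y = 2 * Z) :
    ∃ m : ℤ, ev χ (X * Y ^ (p ^ (k+1) - 1)) = m := by
  have : NeZero (p ^ (k+1)) := ⟨pow_ne_zero _ hp.out.ne_zero⟩
  have hq1 : 1 ≤ p ^ (k+1) := NeZero.one_le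
  obtain ⟨σ, hσ⟩ := aut_inv (n := p ^ (k+1)) (K := K)
  have key (W : MonoidAlgebra ℤ P) (hW : W * iv P W = (p : MonoidAlgebra ℤ P) ^ (2 * a)) :=
    key_root hodd σ hσ a (ev χ W) (ev_isIntegral χ W) (by
      rw [aut_ev σ (by rwa [hP]), ← map_mul, hW]; simp)
  obtain ⟨η, hη, hx⟩ := key X hX
  obtain ⟨μ, hμ, hy⟩ := key Y hY
  have hqodd : Odd (p ^ (k+1)) := hodd.pow
  set q := p ^ (k+1) with hq
  have hz : ev χ X - ev χ Y = 2 * ev χ Z := by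
    rw [← map_sub, hZ, map_mul, map_ofNat]
  have hθ : η * μ ^ (q - 1) = 1 := by
    have hηi : IsIntegral ℤ η := IsIntegral.of_pow (n := q) (by omega) (hη ▸ isIntegral_one)
    have hμi : IsIntegral ℤ μ := IsIntegral.of_pow (n := q) (by omega) (hμ ▸ isIntegral_one)
    let A : 𝓞 K := ⟨η, hηi⟩
    let B : 𝓞 K := ⟨μ, hμi⟩
    let C : 𝓞 K := ⟨ev χ Z, ev_isIntegral χ Z⟩
    have hA : ((A : 𝓞 K) : K) = η := rfl
    have hB : ((B : 𝓞 K) : K) = μ := rfl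
    have hC : ((C : 𝓞 K) : K) = ev χ Z := rfl
    have h22 : ((2 : 𝓞 K) : K) = 2 := rfl
    have hBB : B * B ^ (q - 1) = 1 := by
      rw [← pow_succ', Nat.sub_add_cancel hq1]
      apply RingOfIntegers.ext
      push_cast
      exact hμ
    have hAA : A ^ q = 1 := by
      apply RingOfIntegers.ext
      push_cast
      exact hη
    have hBq : B ^ q = 1 := by
      apply RingOfIntegers.ext
      push_cast
      exact hμ
    have h1 : A * B ^ (q - 1) = 1 := by
      apply root_eq_one (A * B ^ (q - 1)) q (p ^ a) hqodd hodd.pow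
      · rw [mul_pow, hAA, pow_right_comm, hBq, one_pow, one_mul]
      · have hAB : (2 : 𝓞 K) ∣ (p ^ a : ℕ) * (A - B) := by
          rcases hx with hx | hx <;> rcases hy with hy | hy <;> rw [hx, hy] at hz
          · refine ⟨C, RingOfIntegers.ext ?_⟩
            push_cast [hA, hB, hC, h22]
            linear_combination hz
          · refine ⟨C - p ^ a * B, RingOfIntegers.ext ?_⟩
            push_cast [hA, hB, hC, h22]
            linear_combination hz
          · refine ⟨-C - p ^ a * B, RingOfIntegers.ext ?_⟩
            push_cast [hA, hB, hC, h22]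
            linear_combination -hz
          · refine ⟨-C, RingOfIntegers.ext ?_⟩
            push_cast [hA, hB, hC, h22]
            linear_combination -hz
        have : ((p ^ a : ℕ) : 𝓞 K) * (A * B ^ (q - 1) - 1)
            = (p ^ a : ℕ) * (A - B) * B ^ (q - 1) := by
          linear_combination (((p ^ a : ℕ) : 𝓞 K)) * hBB
        rw [this]
        exact hAB.mul_right _
    have := congrArg (fun x : 𝓞 K => (x : K)) h1
    push_cast at this
    exact this
  have hy' : ev χ Y ^ (q - 1) = ((p : K) ^ a) ^ (q - 1) * μ ^ (q - 1) := by
    have hev : Even (q - 1) := hqodd.tsub_odd odd_one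
    rcases hy with hy | hy <;> rw [hy]
    · rw [mul_pow]
    · rw [hev.neg_pow, mul_pow]
  rw [map_mul, map_pow, hy']
  rcases hx with hx | hx <;> rw [hx]
  · refine ⟨(p : ℤ) ^ a * ((p : ℤ) ^ a) ^ (q - 1), ?_⟩
    push_cast
    linear_combination ((p : K) ^ a * ((p : K) ^ a) ^ (q - 1)) * hθ
  · refine ⟨-((p : ℤ) ^ a * ((p : ℤ) ^ a) ^ (q - 1)), ?_⟩
    push_cast
    linear_combination -((p : K) ^ a * ((p : K) ^ a) ^ (q - 1)) * hθ

/-- Integrality of all character values implies invariance under power maps. -/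
lemma coeff_invariant [Fintype P] {q : ℕ} [NeZero q] {K : Type*} [Field K]
    [NumberField K] [IsCyclotomicExtension {q} ℚ K] (hP : Fintype.card P = q)
    (R : MonoidAlgebra ℤ P) (hR : ∀ χ : P →* K, ∃ m : ℤ, ev χ R = m) (t : ℕ) (ht : t.Coprime q)
    (g : P) : R.coeff (g ^ t) = R.coeff g := by
  classical
  have hen : HasEnoughRootsOfUnity K q := ⟨⟨_, zeta_spec q ℚ K⟩, inferInstance⟩
  have : HasEnoughRootsOfUnity K (Monoid.exponent P) := by
    apply HasEnoughRootsOfUnity.of_dvd K (n := q)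
    rw [← hP, ← Nat.card_eq_fintype_card]
    exact Group.exponent_dvd_nat_card
  have hfin : Finite (P →* Kˣ) :=
    Finite.of_equiv _ (CommGroup.monoidHom_mulEquiv_of_hasEnoughRootsOfUnity P K).some.symm.toEquiv
  have := Fintype.ofFinite (P →* Kˣ)
  have hsum (h : P) (hh : h ≠ 1) : ∑ χ : P →* Kˣ, ((χ h : Kˣ) : K) = 0 := by
    obtain ⟨ψ, hψ⟩ := CommGroup.exists_apply_ne_one_of_hasEnoughRootsOfUnity P K hh
    have h1 : ∑ χ : P →* Kˣ, ((χ h : Kˣ) : K) = ∑ χ : P →* Kˣ, (((ψ * χ) h : Kˣ) : K) :=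
      (Equiv.sum_comp (Equiv.mulLeft ψ) (fun χ : P →* Kˣ => ((χ h : Kˣ) : K))).symm
    simp only [MonoidHom.mul_apply, Units.val_mul, ← Finset.mul_sum] at h1
    have h2 : (((ψ h : Kˣ) : K) - 1) * ∑ χ : P →* Kˣ, ((χ h : Kˣ) : K) = 0 := by
      linear_combination -h1
    refine (mul_eq_zero.1 h2).resolve_left (sub_ne_zero.2 ?_)
    rwa [Ne, Units.val_eq_one]
  have hinv (x : P) : ∑ χ : P →* Kˣ, ev ((Units.coeHom K).comp χ) R * ((χ x⁻¹ : Kˣ) : K)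
      = Fintype.card (P →* Kˣ) * (R.coeff x : K) := by
    simp only [ev_eq_sum, Finset.sum_mul]
    rw [Finset.sum_comm]
    rw [Finset.sum_eq_single x]
    · simp
    · intro y _ hy
      have := hsum (y * x⁻¹) (by rwa [Ne, mul_inv_eq_one])
      simp only [MonoidHom.comp_apply, Units.coeHom_apply, mul_assoc, ← Units.val_mul, ← map_mul]
      rw [← Finset.mul_sum, this, mul_zero]
    · simp
  obtain ⟨σ, hσ⟩ := exists_aut (n := q) (K := K) t ht
  have h1 := congrArg σ (hinv g)
  rw [map_mul, map_natCast, map_intCast, map_sum] at h1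
  have h2 := hinv (g ^ t)
  have h3 : ∀ χ : P →* Kˣ, σ (ev ((Units.coeHom K).comp χ) R * ((χ g⁻¹ : Kˣ) : K)) =
      ev ((Units.coeHom K).comp χ) R * ((χ (g ^ t)⁻¹ : Kˣ) : K) := by
    intro χ
    obtain ⟨m, hm⟩ := hR ((Units.coeHom K).comp χ)
    rw [hm, map_mul, map_intCast, hσ]
    · rw [← inv_pow, map_pow, Units.val_pow_eq_pow_val]
    · rw [← Units.val_pow_eq_pow_val, ← map_pow, ← hP, pow_card_eq_one, map_one, Units.val_one]
  simp only [h3] at h1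
  rw [h1] at h2
  have hc : (Fintype.card (P →* Kˣ) : K) ≠ 0 := Nat.cast_ne_zero.2 Fintype.card_ne_zero
  have := mul_left_cancel₀ hc h2
  exact_mod_cast this.symm
end GR

lemma sum_dvd {P : Type*} [CommGroup P] [Fintype P] [DecidableEq P] {p n : ℕ} (hp : p.Prime)
    (hP : Fintype.card P = p ^ n) (F : P → ℤ) (c : ℤ)
    (hF : ∀ t : ℕ, t.Coprime (p ^ n) → ∀ g, F (g ^ t) = F g) (hc : ∀ g, c ∣ F g) :
    c * ((p : ℤ) - 1) ∣ ∑ g ∈ univ.erase (1 : P), F g := by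
  classical
  rw [← Finset.sum_fiberwise_of_maps_to (s := univ.erase (1 : P))
    (t := (univ.erase (1 : P)).image Subgroup.zpowers) (g := Subgroup.zpowers)
    (fun g hg => Finset.mem_image_of_mem _ hg)]
  apply Finset.dvd_sum
  intro C hC
  obtain ⟨g, hg, rfl⟩ := Finset.mem_image.1 hC
  have hg1 : g ≠ 1 := Finset.ne_of_mem_erase hg
  obtain ⟨k, hk, hord⟩ : ∃ k, k ≤ n ∧ orderOf g = p ^ k :=
    (Nat.dvd_prime_pow hp).1 (hP ▸ orderOf_dvd_card)
  have hk0 : k ≠ 0 := by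
    rintro rfl
    rw [pow_zero, orderOf_eq_one_iff] at hord
    exact hg1 hord
  have hcop (i : ℕ) (hi : (p ^ k).Coprime i) : i.Coprime (p ^ n) :=
    Nat.Coprime.pow_right _ (Nat.Coprime.coprime_dvd_left (dvd_pow_self p hk0) hi).symm
  have hfib : (univ.erase (1 : P)).filter (fun x => Subgroup.zpowers x = Subgroup.zpowers g)
      = ((range (p ^ k)).filter (fun i => (p ^ k).Coprime i)).image (fun i => g ^ i) := by
    ext x
    simp only [mem_filter, mem_erase, mem_univ, and_true, mem_image, mem_range]
    constructor
    · rintro ⟨-, hx⟩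
      have hxm : x ∈ Subgroup.zpowers g := hx ▸ Subgroup.mem_zpowers x
      obtain ⟨i, hi, rfl⟩ := Finset.mem_image.1 (mem_zpowers_iff_mem_range_orderOf.1 hxm)
      rw [mem_range, hord] at hi
      refine ⟨i, ⟨hi, ?_⟩, rfl⟩
      have h1 : g ∈ Subgroup.zpowers (g ^ i) := hx ▸ Subgroup.mem_zpowers g
      rw [mem_zpowers_pow_iff, hord] at h1
      first | exact h1 | exact Nat.Coprime.symm h1
    · rintro ⟨i, ⟨hi, hi2⟩, rfl⟩
      have h1 : g ∈ Subgroup.zpowers (g ^ i) := by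
        rw [mem_zpowers_pow_iff, hord]
        first | exact hi2 | exact Nat.Coprime.symm hi2
      have h2 : Subgroup.zpowers (g ^ i) = Subgroup.zpowers g :=
        le_antisymm (Subgroup.zpowers_le.2 (Subgroup.pow_mem _ (Subgroup.mem_zpowers g) i))
          (Subgroup.zpowers_le.2 h1)
      refine ⟨?_, h2⟩
      intro h3
      rw [h3, Subgroup.zpowers_one_eq_bot] at h1
      exact hg1 (Subgroup.mem_bot.1 h1)
  rw [hfib, Finset.sum_image]
  · rw [Finset.sum_congr rfl (fun i hi => hF i (hcop i (Finset.mem_filter.1 hi).2) g),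
      Finset.sum_const, ← Nat.totient_eq_card_coprime, Nat.totient_prime_pow hp (Nat.pos_of_ne_zero hk0)]
    obtain ⟨y, hy⟩ := hc g
    refine ⟨p ^ (k - 1) * y, ?_⟩
    rw [hy, nsmul_eq_mul]
    push_cast [hp.one_le]
    ring
  · intro i hi j hj hij
    rw [Finset.mem_coe, Finset.mem_filter, Finset.mem_range, ← hord] at hi hj
    exact pow_injOn_Iio_orderOf hi.1 hj.1 hij

lemma arith (p a : ℕ) (hp1 : 1 < p) (hp4 : p % 4 = 1) (ha : Odd a) (r A B s T q : ℤ)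
    (hq : q = (p : ℤ) ^ (2 * a)) (hT : T = ((p : ℤ) ^ a) ^ (p ^ (2 * a) - 1))
    (hs : s = (p : ℤ) ^ a ∨ s = -(p : ℤ) ^ a)
    (h1 : r + 2 * ((p : ℤ) - 1) * A + (q - 1) = s * T)
    (h2 : r ^ 2 + 8 * ((p : ℤ) - 1) * B + (q - 1) = T ^ 2 * q) : False := by
  obtain ⟨e, he⟩ : ∃ e : ℤ, (p : ℤ) = 4 * e + 1 := ⟨p / 4, by omega⟩
  have he0 : e ≠ 0 := by omega
  have hpodd : Odd p := by rw [Nat.odd_iff]; omega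
  -- the number `T` is one modulo `8 (p - 1)`
  obtain ⟨j, hj⟩ : 8 ∣ p ^ (2 * a) - 1 := by
    have h := Int.eight_dvd_sq_sub_one_of_odd (((Int.odd_coe_nat p).2 hpodd).pow (n := a))
    have h3 : ((p ^ (2 * a) - 1 : ℕ) : ℤ) = ((p : ℤ) ^ a) ^ 2 - 1 := by
      rw [Nat.cast_sub (Nat.one_le_pow _ _ (by omega))]
      push_cast
      ring
    rw [← h3] at h
    exact_mod_cast h
  have hT8 : (p : ℤ) ^ 8 - 1 ∣ T - 1 := by
    have h3 : T = ((p : ℤ) ^ 8) ^ (a * j) := by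
      rw [hT, hj, ← pow_mul, ← pow_mul]
      congr 1
      ring
    rw [h3]
    simpa using sub_dvd_pow_sub_pow ((p : ℤ) ^ 8) 1 (a * j)
  have hp8 : 32 * e ∣ (p : ℤ) ^ 8 - 1 := by
    refine ⟨(2 * e + 1) * (8 * e ^ 2 + 4 * e + 1) * (128 * e ^ 4 + 128 * e ^ 3 + 48 * e ^ 2 + 8 * e + 1), ?_⟩
    rw [he]
    ring
  obtain ⟨t, ht⟩ := hp8.trans hT8
  have hp2 : 8 * e ∣ ((p : ℤ) ^ 2) - 1 := ⟨2 * e + 1, by rw [he]; ring⟩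
  obtain ⟨i, hi⟩ := ha
  obtain ⟨x, hx⟩ : 8 * e ∣ ((p : ℤ) ^ 2) ^ a - 1 :=
    hp2.trans (by simpa using sub_dvd_pow_sub_pow ((p : ℤ) ^ 2) 1 a)
  obtain ⟨y, hy⟩ : 8 * e ∣ ((p : ℤ) ^ 2) ^ i - 1 :=
    hp2.trans (by simpa using sub_dvd_pow_sub_pow ((p : ℤ) ^ 2) 1 i)
  have hq' : q = 1 + 8 * e * x := by rw [hq, pow_mul]; linarith
  have hpa : (p : ℤ) ^ a = (1 + 8 * e * y) * (4 * e + 1) := by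
    rw [hi, pow_succ, pow_mul, ← he, show ((p : ℤ) ^ 2) ^ i = 1 + 8 * e * y by linarith]
  have hT' : T = 1 + 32 * e * t := by linarith
  obtain ⟨u, hu⟩ : ∃ u, r ^ 2 = (1 + 4 * e + 8 * e * u) ^ 2 := by
    rcases hs with h | h
    · refine ⟨-A - x + y * (4 * e + 1) + (1 + 8 * e * y) * (4 * e + 1) * 4 * t, ?_⟩
      congr 1
      rw [h, hpa, hT', hq', he] at h1
      linear_combination h1
    · refine ⟨A + x + y * (4 * e + 1) + (1 + 8 * e * y) * (4 * e + 1) * 4 * t, ?_⟩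
      rw [← neg_sq r]
      congr 1
      rw [h, hpa, hT', hq', he] at h1
      linear_combination -h1
  rw [hu, hT', hq', he] at h2
  have h5 : 8 * e * (1 + 2 * (e + u + 4 * e * u + 4 * e * u ^ 2)
      + 4 * B - (2 * t * 4 + 128 * e * t ^ 2) * (1 + 8 * e * x)) = 0 := by
    linear_combination h2
  have h6 := (mul_eq_zero.1 h5).resolve_left (by omega)
  have h7 : 2 * ((e + u + 4 * e * u + 4 * e * u ^ 2)
      + 2 * B - (t * 4 + 64 * e * t ^ 2) * (1 + 8 * e * x)) = -1 := by linear_combination h6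
  omega

section GR2
variable {P : Type*} [CommGroup P]

/-- Augmentation. -/
noncomputable def aug (P : Type*) [CommGroup P] : MonoidAlgebra ℤ P →ₐ[ℤ] ℤ :=
  MonoidAlgebra.lift ℤ ℤ P 1

lemma aug_single (g : P) (c : ℤ) : aug P (.single g c) = c := by simp [aug]

lemma aug_eq_sum [Fintype P] (X : MonoidAlgebra ℤ P) : aug P X = ∑ g, X.coeff g := by
  rw [aug, MonoidAlgebra.lift_apply, Finsupp.sum_fintype _ _ (by simp)]
  simp

lemma aug_iv (X : MonoidAlgebra ℤ P) : aug P (iv P X) = aug P X := by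
  induction X using MonoidAlgebra.induction_linear with
  | zero => simp
  | add f g hf hg => simp [hf, hg]
  | single g c => rw [iv_single, aug_single, aug_single]

lemma iv_coeff (X : MonoidAlgebra ℤ P) (g : P) : (iv P X).coeff g = X.coeff g⁻¹ := by
  classical
  induction X using MonoidAlgebra.induction_linear with
  | zero => simp
  | add f g hf hg => simp [hf, hg]
  | single h c => 
    rw [iv_single, MonoidAlgebra.coeff_single, MonoidAlgebra.coeff_single, Finsupp.single_apply,
      Finsupp.single_apply]
    simp only [inv_eq_iff_eq_inv]

lemma mul_iv_coeff_one [Fintype P] (X : MonoidAlgebra ℤ P) :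
    (X * iv P X).coeff 1 = ∑ g, X.coeff g ^ 2 := by
  rw [MonoidAlgebra.coeff_mul_apply_left, Finsupp.sum_fintype _ _ (by simp)]
  simp [iv_coeff, sq]

/-- Sum of all group elements. -/
noncomputable def J (P : Type*) [CommGroup P] [Fintype P] : MonoidAlgebra ℤ P :=
  ∑ g, .single g 1

lemma J_coeff [Fintype P] (g : P) : (J P).coeff g = 1 := by
  classical
  simp [J, MonoidAlgebra.coeff_sum, Finsupp.single_apply]

lemma J_mul [Fintype P] (X : MonoidAlgebra ℤ P) : J P * X = (aug P X : ℤ) • J P := by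
  induction X using MonoidAlgebra.induction_linear with
  | zero => simp
  | add f g hf hg => rw [mul_add, hf, hg, map_add, add_smul]
  | single h c =>
    rw [aug_single]
    ext x
    rw [MonoidAlgebra.coeff_mul_single_apply, MonoidAlgebra.coeff_smul, Finsupp.smul_apply,
      J_coeff, J_coeff]
    simp

lemma iv_J [Fintype P] : iv P (J P) = J P := by
  ext x
  rw [iv_coeff, J_coeff, J_coeff]

lemma aug_J [Fintype P] : aug P (J P) = Fintype.card P := by
  rw [aug_eq_sum]; simp [J_coeff]

lemma core' (K : Type*) [Field K] [NumberField K] [Fintype P] {p a : ℕ}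
    [hcyc : IsCyclotomicExtension {p ^ (2 * a)} ℚ K] (hp : p.Prime) (hp4 : p % 4 = 1) (ha : Odd a)
    (hP : Fintype.card P = p ^ (2 * a)) (X : Fin 4 → MonoidAlgebra ℤ P) (d : MonoidAlgebra ℤ P)
    (hd : ∀ g, (J P - 2 * d).coeff g ^ 2 = 1)
    (hX : ∀ i, X i * iv P (X i) = (p : MonoidAlgebra ℤ P) ^ (2 * a))
    (hZ : ∀ i, ∃ Z, X i - X 0 = 2 * Z)
    (hs : 2 * (J P - 2 * d) = ∑ i, X i) : False := by
  classical
  have : Fact p.Prime := ⟨hp⟩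
  have hodd : Odd p := by rw [Nat.odd_iff]; omega
  have hapos : 0 < a := ha.pos
  obtain ⟨k, hk⟩ : ∃ k, 2 * a = k + 1 := ⟨2 * a - 1, by omega⟩
  set q := p ^ (2 * a) with hq
  have hq' : q = p ^ (k + 1) := by rw [hq, hk]
  have : NeZero q := ⟨pow_ne_zero _ hp.ne_zero⟩
  have hqodd : Odd q := hodd.pow
  have hcyc' : IsCyclotomicExtension {p ^ (k + 1)} ℚ K := hq' ▸ hcyc
  set f := J P - 2 * d with hf
  set V := X 0 ^ (q - 1) with hV
  set R := f * V with hR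
  have hR2 : 2 * R = ∑ i, X i * V := by rw [hR, ← mul_assoc, hs, Finset.sum_mul]
  -- invariance
  have hinv (t : ℕ) (ht : t.Coprime q) (g : P) : R.coeff (g ^ t) = R.coeff g := by
    have := coeff_invariant (K := K) hP (2 * R) (fun χ => by
      have h1 (i) : ∃ m : ℤ, ev χ (X i * V) = m := by
        obtain ⟨Z, hZ'⟩ := hZ i
        have := ev_int (k := k) hodd (hP.trans hq') χ a (X i) (X 0) Z (hX i) (hX 0) hZ'
        rwa [← hq'] at this
      choose m hm using h1
      refine ⟨∑ i, m i, ?_⟩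
      rw [hR2, map_sum, Int.cast_sum]
      exact Finset.sum_congr rfl (fun i _ => hm i)) t ht g
    rw [two_mul, MonoidAlgebra.coeff_add] at this
    simp only [Finsupp.add_apply] at this
    omega
  -- augmentations
  have haug (i) : aug P (X i) = (p : ℤ) ^ a ∨ aug P (X i) = -(p : ℤ) ^ a := by
    have := congrArg (aug P) (hX i)
    rw [map_mul, aug_iv, map_pow, map_natCast] at this
    rw [← sq_eq_sq_iff_eq_or_eq_neg, sq, this, ← pow_mul, mul_comm]
  set T : ℤ := ((p : ℤ) ^ a) ^ (q - 1) with hT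
  have hTodd : Odd T := ((Int.odd_coe_nat p).2 hodd).pow.pow
  have hVaug : aug P V = T := by
    have hev : Even (q - 1) := hqodd.tsub_odd odd_one
    rw [hV, map_pow]
    rcases haug 0 with h | h <;> rw [h]
    rw [hev.neg_pow]
  have hRodd (g : P) : Odd (R.coeff g) := by
    have h1 : R = T • J P - (d * V + d * V) := by
      rw [← hVaug, ← J_mul, hR, hf]; ring
    rw [h1, MonoidAlgebra.coeff_sub, MonoidAlgebra.coeff_add, MonoidAlgebra.coeff_smul]
    simp only [Finsupp.sub_apply, Finsupp.add_apply, Finsupp.smul_apply, J_coeff, smul_eq_mul,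
      mul_one]
    exact hTodd.sub_even ⟨_, rfl⟩
  have hsum : ∑ g, R.coeff g = aug P f * T := by
    rw [← aug_eq_sum, hR, map_mul, hVaug]
  have hVV : V * iv P V = ((T ^ 2 : ℤ) : MonoidAlgebra ℤ P) := by
    rw [hV, map_pow, ← mul_pow, hX 0, hT]
    push_cast
    ring
  have hsq : ∑ g, R.coeff g ^ 2 = T ^ 2 * q := by
    rw [← mul_iv_coeff_one]
    have : R * iv P R = (T ^ 2) • (f * iv P f) := by
      rw [hR, map_mul, zsmul_eq_mul, ← hVV]; ring
    rw [this, MonoidAlgebra.coeff_smul, Finsupp.smul_apply, mul_iv_coeff_one,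
      Finset.sum_congr rfl (fun g _ => hd g)]
    simp [hP]
  have hfs : aug P f = (p : ℤ) ^ a ∨ aug P f = -(p : ℤ) ^ a := by
    have h1 := congrArg (aug P) hs
    rw [map_mul, map_ofNat, map_sum, Fin.sum_univ_four] at h1
    have h2 : Odd (aug P f) := by
      rw [hf, map_sub, map_mul, aug_J, map_ofNat, hP]
      exact ((Int.odd_coe_nat q).2 hqodd).sub_even (even_two_mul _)
    obtain ⟨m, hm⟩ := h2
    have h3 : Odd ((p : ℤ) ^ a) := ((Int.odd_coe_nat p).2 hodd).pow
    obtain ⟨l, hl⟩ := h3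
    rcases haug 0 with k0 | k0 <;> rcases haug 1 with k1 | k1 <;>
      rcases haug 2 with k2 | k2 <;> rcases haug 3 with k3 | k3 <;>
      rw [k0, k1, k2, k3] at h1 <;> omega
  have hcardE : ((univ.erase (1 : P)).card : ℤ) = q - 1 := by
    rw [Finset.card_erase_of_mem (mem_univ _), Finset.card_univ, hP,
      Nat.cast_sub NeZero.one_le, Nat.cast_one]
  obtain ⟨A, hA⟩ := sum_dvd hp hP (fun g => R.coeff g - 1) 2
    (fun t ht g => by simp only [hinv t ht g]) (fun g => by
      obtain ⟨m, hm⟩ := hRodd g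
      exact ⟨m, by rw [hm]; ring⟩)
  obtain ⟨B, hB⟩ := sum_dvd hp hP (fun g => R.coeff g ^ 2 - 1) 8
    (fun t ht g => by simp only [hinv t ht g]) (fun g => Int.eight_dvd_sq_sub_one_of_odd (hRodd g))
  rw [Finset.sum_sub_distrib, Finset.sum_const, nsmul_eq_mul, mul_one, hcardE] at hA hB
  rw [← Finset.add_sum_erase _ _ (mem_univ (1 : P))] at hsum hsq
  refine arith p a hp.one_lt hp4 ha (R.coeff 1) A B (aug P f) T q (by rw [hq]; push_cast; rfl) hT hfs ?_ ?_
  · linear_combination hsum - hA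
  · linear_combination hsq - hB

lemma core [Fintype P] {p a : ℕ} (hp : p.Prime) (hp4 : p % 4 = 1) (ha : Odd a)
    (hP : Fintype.card P = p ^ (2 * a)) (X : Fin 4 → MonoidAlgebra ℤ P) (d : MonoidAlgebra ℤ P)
    (hd : ∀ g, (J P - 2 * d).coeff g ^ 2 = 1)
    (hX : ∀ i, X i * iv P (X i) = (p : MonoidAlgebra ℤ P) ^ (2 * a))
    (hZ : ∀ i, ∃ Z, X i - X 0 = 2 * Z)
    (hs : 2 * (J P - 2 * d) = ∑ i, X i) : False := by
  have : NeZero (p ^ (2 * a)) := ⟨pow_ne_zero _ hp.ne_zero⟩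
  have : @IsCyclotomicExtension {p ^ (2 * a)} ℚ (CyclotomicField (p ^ (2 * a)) ℚ) _ _
      DivisionRing.toRatAlgebra := by
    have h : (DivisionRing.toRatAlgebra : Algebra ℚ (CyclotomicField (p ^ (2 * a)) ℚ)) =
      CyclotomicField.algebra (p ^ (2 * a)) ℚ := Subsingleton.elim _ _
    rw [h]
    exact CyclotomicField.isCyclotomicExtension (p ^ (2 * a)) ℚ
  exact core' (CyclotomicField (p ^ (2 * a)) ℚ) hp hp4 ha hP X d hd hX hZ hs
end GR2

section Final

lemma ds_mul {G : Type*} [CommGroup G] [Fintype G] [DecidableEq G] (D : Finset G) (M : ℕ)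
    (hM : 0 < M) (hc : Fintype.card G = 4 * M ^ 2) (hk : D.card = 2 * M ^ 2 - M)
    (hD : ∀ g : G, g ≠ 1 →
      ((D ×ˢ D).filter (fun x => x.1 * x.2⁻¹ = g)).card = M ^ 2 - M) :
    (J G - 2 * ∑ g ∈ D, .single g 1) * iv G (J G - 2 * ∑ g ∈ D, .single g 1)
      = (4 * M ^ 2 : MonoidAlgebra ℤ G) := by
  set Δ : MonoidAlgebra ℤ G := ∑ g ∈ D, .single g 1 with hΔ
  have hMM : M ≤ M ^ 2 := Nat.le_self_pow two_ne_zero M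
  have hkz : (D.card : ℤ) = 2 * (M : ℤ) ^ 2 - M := by
    rw [hk, Nat.cast_sub (by omega)]; push_cast; ring
  have hlz : ((M ^ 2 - M : ℕ) : ℤ) = (M : ℤ) ^ 2 - M := by
    rw [Nat.cast_sub hMM]; push_cast; ring
  have haugΔ : aug G Δ = D.card := by
    rw [hΔ, map_sum]
    simp [aug_single]
  have hmul : Δ * iv G Δ = ((M : ℤ) ^ 2) • 1 + ((M : ℤ) ^ 2 - M) • J G := by
    have h1 : Δ * iv G Δ = ∑ x ∈ D ×ˢ D, .single (x.1 * x.2⁻¹) 1 := by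
      rw [hΔ, map_sum, Finset.sum_mul_sum, Finset.sum_product]
      refine Finset.sum_congr rfl (fun x _ => Finset.sum_congr rfl (fun y _ => ?_))
      rw [iv_single, MonoidAlgebra.single_mul_single, mul_one]
    ext g
    have h2 : (Δ * iv G Δ).coeff g = ((D ×ˢ D).filter (fun x => x.1 * x.2⁻¹ = g)).card := by
      rw [h1, MonoidAlgebra.coeff_sum, Finsupp.finsetSum_apply, Finset.card_filter]
      push_cast
      refine Finset.sum_congr rfl (fun x _ => ?_)
      rw [MonoidAlgebra.coeff_single, Finsupp.single_apply]
    rw [h2, MonoidAlgebra.coeff_add, MonoidAlgebra.coeff_smul, MonoidAlgebra.coeff_smul,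
      Finsupp.add_apply, Finsupp.smul_apply, Finsupp.smul_apply, J_coeff,
      MonoidAlgebra.one_def, MonoidAlgebra.coeff_single, Finsupp.single_apply]
    by_cases hg : g = 1
    · subst hg
      have h3 : ((D ×ˢ D).filter (fun x => x.1 * x.2⁻¹ = 1)).card = D.card := by
        rw [← Finset.diag_card (s := D)]
        refine congrArg Finset.card ?_
        ext ⟨x, y⟩
        simp only [mem_filter, mem_product, mem_diag, mul_inv_eq_one]
        constructor
        · rintro ⟨⟨h, -⟩, h'⟩
          exact ⟨h, h'⟩
        · rintro ⟨h, h'⟩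
          exact ⟨⟨h, h' ▸ h⟩, h'⟩
      rw [h3, hkz]
      simp
      ring
    · rw [hD g hg, hlz, if_neg (Ne.symm hg)]
      simp
  have hJΔ : J G * iv G Δ = (2 * (M : ℤ) ^ 2 - M) • J G := by
    rw [J_mul, aug_iv, haugΔ, hkz]
  have hJΔ2 : J G * Δ = (2 * (M : ℤ) ^ 2 - M) • J G := by
    rw [J_mul, haugΔ, hkz]
  have hJJ : J G * J G = (4 * (M : ℤ) ^ 2) • J G := by
    rw [J_mul, aug_J, hc]; push_cast; rfl
  rw [map_sub, map_mul, map_ofNat, iv_J]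
  simp only [zsmul_eq_mul] at *
  push_cast at *
  linear_combination hJJ - 2 * hJΔ - 2 * hJΔ2 + 4 * hmul

/-- The nontrivial sign character. -/
def sgn : Multiplicative (ZMod 2) →* ℤ where
  toFun a := if a = 1 then 1 else -1
  map_one' := by decide
  map_mul' := by decide

variable {P : Type*} [CommGroup P]

/-- Partial evaluation at a pair of characters of the two factors of order two. -/
noncomputable def th (P : Type*) [CommGroup P] (φ₁ φ₂ : Multiplicative (ZMod 2) →* ℤ) :
    MonoidAlgebra ℤ (Multiplicative (ZMod 2) × Multiplicative (ZMod 2) × P) →ₐ[ℤ]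
      MonoidAlgebra ℤ P :=
  MonoidAlgebra.lift ℤ (MonoidAlgebra ℤ P) _
    { toFun := fun g => .single g.2.2 (φ₁ g.1 * φ₂ g.2.1)
      map_one' := by simp [MonoidAlgebra.one_def]
      map_mul' := by
        intro x y
        rw [MonoidAlgebra.single_mul_single]
        simp only [Prod.fst_mul, Prod.snd_mul, map_mul]
        congr 1
        ring }

lemma th_single (φ₁ φ₂ : Multiplicative (ZMod 2) →* ℤ)
    (g : Multiplicative (ZMod 2) × Multiplicative (ZMod 2) × P) (c : ℤ) :
    th P φ₁ φ₂ (.single g c) = (φ₁ g.1 * φ₂ g.2.1) • .single g.2.2 c := by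
  simp [th, mul_comm]

lemma inv_self (a : Multiplicative (ZMod 2)) : a⁻¹ = a := by
  revert a
  decide

lemma th_iv (φ₁ φ₂ : Multiplicative (ZMod 2) →* ℤ)
    (X : MonoidAlgebra ℤ (Multiplicative (ZMod 2) × Multiplicative (ZMod 2) × P)) :
    th P φ₁ φ₂ (iv _ X) = iv P (th P φ₁ φ₂ X) := by
  induction X using MonoidAlgebra.induction_linear with
  | zero => simp
  | add f g hf hg => simp [hf, hg]
  | single h c =>
    rw [iv_single, th_single, th_single, map_zsmul, iv_single]
    simp only [Prod.fst_inv, Prod.snd_inv, inv_self]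

lemma sum_two {A : Type*} [AddCommMonoid A] (f : Multiplicative (ZMod 2) → A) :
    ∑ a, f a = f 1 + f (Multiplicative.ofAdd 1) :=
  Fin.sum_univ_two f

/-- The slice of `D` over a pair of elements of the groups of order two. -/
noncomputable def sl [Fintype P] [DecidableEq P]
    (D : Finset (Multiplicative (ZMod 2) × Multiplicative (ZMod 2) × P))
    (a b : Multiplicative (ZMod 2)) : MonoidAlgebra ℤ P :=
  ∑ x, .single x (if (a, b, x) ∈ D then 1 else 0)

lemma th_F [Fintype P] [DecidableEq P]
    (D : Finset (Multiplicative (ZMod 2) × Multiplicative (ZMod 2) × P))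
    (φ₁ φ₂ : Multiplicative (ZMod 2) →* ℤ) :
    th P φ₁ φ₂ (J _ - 2 * ∑ g ∈ D, .single g 1)
      = ∑ a, ∑ b, (φ₁ a * φ₂ b) • (J P - 2 * sl D a b) := by
  have h1 : th P φ₁ φ₂ (J _) = ∑ a, ∑ b, (φ₁ a * φ₂ b) • J P := by
    rw [J, map_sum, Fintype.sum_prod_type]
    refine Finset.sum_congr rfl (fun a _ => ?_)
    rw [Fintype.sum_prod_type]
    refine Finset.sum_congr rfl (fun b _ => ?_)
    rw [J, Finset.smul_sum]
    exact Finset.sum_congr rfl (fun x _ => th_single _ _ _ _)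
  have h2 : th P φ₁ φ₂ (∑ g ∈ D, .single g 1) = ∑ a, ∑ b, (φ₁ a * φ₂ b) • sl D a b := by
    have h3 : (∑ g ∈ D, .single g 1 :
        MonoidAlgebra ℤ (Multiplicative (ZMod 2) × Multiplicative (ZMod 2) × P))
        = ∑ g, .single g (if g ∈ D then 1 else 0) := by
      rw [← Finset.sum_filter_add_sum_filter_not univ (fun g => g ∈ D)]
      rw [Finset.sum_eq_zero (s := univ.filter (fun g => ¬ g ∈ D)), add_zero]
      · rw [Finset.filter_univ_mem]
        exact Finset.sum_congr rfl (fun x hx => by rw [if_pos hx])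
      · intro x hx
        rw [if_neg (Finset.mem_filter.1 hx).2, MonoidAlgebra.single_zero]
    rw [h3, map_sum, Fintype.sum_prod_type]
    refine Finset.sum_congr rfl (fun a _ => ?_)
    rw [Fintype.sum_prod_type]
    refine Finset.sum_congr rfl (fun b _ => ?_)
    rw [sl, Finset.smul_sum]
    exact Finset.sum_congr rfl (fun x _ => th_single _ _ _ _)
  rw [map_sub, map_mul, map_ofNat, h1, h2, Finset.mul_sum, ← Finset.sum_sub_distrib]
  refine Finset.sum_congr rfl (fun a _ => ?_)
  rw [Finset.mul_sum, ← Finset.sum_sub_distrib]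
  refine Finset.sum_congr rfl (fun b _ => ?_)
  rw [smul_sub, mul_smul_comm]

lemma cancel (n : ℕ) (E : MonoidAlgebra ℤ P)
    (h : (2 * E) * iv P (2 * E) = (4 * n : MonoidAlgebra ℤ P)) : E * iv P E = n := by
  rw [map_mul, map_ofNat] at h
  have h1 : (4 : ℤ) • (E * iv P E) = (4 : ℤ) • (n : MonoidAlgebra ℤ P) := by
    simp only [zsmul_eq_mul]
    push_cast
    linear_combination h
  ext g
  have h2 := congrArg (fun X => MonoidAlgebra.coeff X g) h1
  simp only [MonoidAlgebra.coeff_smul, Finsupp.smul_apply, smul_eq_mul] at h2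
  omega

lemma final [Fintype P] [DecidableEq P] {p a : ℕ} (hp : p.Prime) (hp4 : p % 4 = 1) (ha : Odd a)
    (hP : Fintype.card P = p ^ (2 * a))
    (D : Finset (Multiplicative (ZMod 2) × Multiplicative (ZMod 2) × P))
    (hF : (J _ - 2 * ∑ g ∈ D, .single g 1) * iv _ (J _ - 2 * ∑ g ∈ D, .single g 1)
      = (4 * (p ^ (2 * a) : ℕ) :
        MonoidAlgebra ℤ (Multiplicative (ZMod 2) × Multiplicative (ZMod 2) × P))) : False := by
  have key (φ₁ φ₂ : Multiplicative (ZMod 2) →* ℤ) (E : MonoidAlgebra ℤ P)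
      (hE : 2 * E = ∑ a, ∑ b, (φ₁ a * φ₂ b) • (J P - 2 * sl D a b)) :
      E * iv P E = (p : MonoidAlgebra ℤ P) ^ (2 * a) := by
    rw [← Nat.cast_pow]
    apply cancel
    rw [hE, ← th_F, ← th_iv, ← map_mul, hF, map_mul, map_ofNat, map_natCast]
  have hs1 : sgn 1 = 1 := by decide
  have hsw : sgn (Multiplicative.ofAdd 1) = -1 := by decide
  simp only [sum_two] at key
  set d0 := sl D 1 1 with hd0
  set d1 := sl D 1 (Multiplicative.ofAdd 1)
  set d2 := sl D (Multiplicative.ofAdd 1) 1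
  set d3 := sl D (Multiplicative.ofAdd 1) (Multiplicative.ofAdd 1)
  refine core hp hp4 ha hP ![2 * J P - (d0 + d1 + d2 + d3), -(d0 - d1 + d2 - d3),
    -(d0 + d1 - d2 - d3), -(d0 - d1 - d2 + d3)] d0 ?_ ?_ ?_ ?_
  · intro g
    have h1 : d0.coeff g = if ((1, 1, g) : _ × _ × P) ∈ D then 1 else 0 := by
      rw [hd0, sl, MonoidAlgebra.coeff_sum, Finsupp.finsetSum_apply]
      simp [Finsupp.single_apply]
    rw [two_mul, MonoidAlgebra.coeff_sub, MonoidAlgebra.coeff_add, Finsupp.sub_apply,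
      Finsupp.add_apply, J_coeff, h1]
    split_ifs <;> norm_num
  · intro i
    fin_cases i
    · refine key 1 1 _ ?_
      simp
      ring
    · refine key 1 sgn _ ?_
      simp [hsw]
      ring
    · refine key sgn 1 _ ?_
      simp [hsw]
      ring
    · refine key sgn sgn _ ?_
      simp [hsw]
      ring
  · intro i
    fin_cases i
    · exact ⟨0, by simp⟩
    · exact ⟨d1 + d3 - J P, by simp; ring⟩
    · exact ⟨d2 + d3 - J P, by simp; ring⟩
    · exact ⟨d1 + d2 - J P, by simp; ring⟩
  · simp [Fin.sum_univ_four]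
    ring
end Final
end HDS

/-- (Ray-Chaudhuri–Xiang) If there is a Hadamard difference set in
`G = ℤ₂ × ℤ₂ × P` with `|P| = p^{2α}`, `p` an odd prime and `α` odd, then `p ≡ 3 (mod 4)`. -/
theorem stmt7 (p α : ℕ) (hp : p.Prime) (hpodd : Odd p) (hα : Odd α) (hα0 : 0 < α)
    (P : Type*) [CommGroup P] [Fintype P] [DecidableEq P]
    (hP : Fintype.card P = p ^ (2 * α))
    (D : Finset (Multiplicative (ZMod 2) × Multiplicative (ZMod 2) × P))
    (M : ℕ) (hM : 0 < M)
    (hcard : Fintype.card (Multiplicative (ZMod 2) × Multiplicative (ZMod 2) × P) = 4 * M ^ 2)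
    (hDS : IsDS D (4 * M ^ 2) (2 * M ^ 2 - M) (M ^ 2 - M)) :
    p % 4 = 3 := by
  by_contra hne
  have hp4 : p % 4 = 1 := by
    have := Nat.odd_iff.1 hpodd
    omega
  have h2 : Fintype.card (Multiplicative (ZMod 2)) = 2 := rfl
  have hMq : M ^ 2 = p ^ (2 * α) := by
    rw [Fintype.card_prod, Fintype.card_prod, h2, hP] at hcard
    omega
  have h := HDS.ds_mul D M hM hcard hDS.2.1 hDS.2.2
  rw [← Nat.cast_pow, hMq] at h
  exact HDS.final hp hp4 hα hP D h
end
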